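/- The set of rational numbers of the form −(a − b + 1)/a, where a and b are integers with a > b ≥ 0, is exactly equal to the set { q ∈ ℚ : −1 ≤ q < 0 } ∪ { −1 − 1/i : i a positive integer }. -/

import Mathlib

theorem stmt_10 :
    {q : ℚ | ∃ a b : ℤ, b < a ∧ 0 ≤ b ∧ q = -((a : ℚ) - (b : ℚ) + 1) / (a : ℚ)} =
    {q : ℚ | -1 ≤ q ∧ q < 0} ∪ {q : ℚ | ∃ i : ℤ, 0 < i ∧ q = -1 - 1 / (i : ℚ)} := by
  ext q
  simp only [Set.mem_ofPred_eq, Set.mem_union]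
  constructor
  · rintro ⟨a, b, hba, hb, rfl⟩
    have ha : (0 : ℚ) < a := by exact_mod_cast hb.trans_lt hba
    have hba' : (b : ℚ) < a := by exact_mod_cast hba
    rcases hb.eq_or_lt with rfl | hb
    · refine Or.inr ⟨a, hba, ?_⟩
      push_cast
      field_simp
      ring
    · have hb' : (1 : ℚ) ≤ b := by exact_mod_cast hb
      refine Or.inl ⟨?_, ?_⟩
      · rw [le_div_iff₀ ha]
        linarith
      · exact div_neg_of_neg_of_pos (by linarith) ha
  · rintro (⟨h₁, h₂⟩ | ⟨i, hi, rfl⟩)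
    · have hd : (0 : ℚ) < q.den := by exact_mod_cast q.den_pos
      have hq : q * q.den = q.num := Rat.mul_den_eq_num q
      have hn : q.num < 0 := Rat.num_neg.mpr h₂
      have hnd : -(q.den : ℤ) ≤ q.num := by
        have : -(q.den : ℚ) ≤ q.num := by nlinarith
        exact_mod_cast this
      -- Doubling the fraction leaves room for `b = a + 1 - 2 * |q.num|` to be less than `a`.
      refine ⟨2 * q.den, 2 * q.den + 2 * q.num + 1, by omega, by omega, ?_⟩
      push_cast
      rw [eq_div_iff (by positivity)]
      linear_combination 2 * hq
    · have hi' : (i : ℚ) ≠ 0 := by exact_mod_cast hi.ne'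
      refine ⟨i, 0, hi, le_rfl, ?_⟩
      push_cast
      field_simp
      ring
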